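/- Let W ⊆ ℂᵈ be open and contractible, let A : W → Mat(n×n,ℂ) be holomorphic, suppose every point of W is Jordan stable for A, and let ξ ∈ W. Then there exists a continuous map T : W → Mat(n×n,ℂ) with T(ζ) invertible for every ζ ∈ W, such that T(ζ)⁻¹·(Com A(ζ))·T(ζ) = Com A(ξ) (equality of subsets of Mat(n×n,ℂ)) for all ζ ∈ W. -/

import Mathlib

/-- A point `ξ` of an open set `W ⊆ ℂᵈ` is Jordan stable for a holomorphic
`A : W → Mat(n×n,ℂ)` if on some neighborhood `U ⊆ W` of `ξ` there are holomorphic functions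
`λ₁,…,λ_m` whose values at each `ζ ∈ U` are pairwise distinct and are exactly the eigenvalues
of `A(ζ)`, and such that for each `j` and each `1 ≤ k ≤ n` the dimension of
`ker((A(ζ) − λ_j(ζ)·I)^k)` is independent of `ζ ∈ U`. -/
def JordanStable {d n : ℕ} (W : Set (Fin d → ℂ))
    (A : (Fin d → ℂ) → Matrix (Fin n) (Fin n) ℂ) (ξ : Fin d → ℂ) : Prop :=
  ∃ U : Set (Fin d → ℂ), IsOpen U ∧ ξ ∈ U ∧ U ⊆ W ∧
    ∃ m : ℕ, ∃ lam : Fin m → (Fin d → ℂ) → ℂ,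
      (∀ j, DifferentiableOn ℂ (lam j) U) ∧
      (∀ ζ ∈ U, Function.Injective fun j => lam j ζ) ∧
      (∀ ζ ∈ U, (Set.range fun j => lam j ζ) = spectrum ℂ (A ζ)) ∧
      (∀ j : Fin m, ∀ k : ℕ, 1 ≤ k → k ≤ n → ∀ ζ₁ ∈ U, ∀ ζ₂ ∈ U,
        Module.finrank ℂ
            (LinearMap.ker (Matrix.toLin' ((A ζ₁ - lam j ζ₁ • (1 : Matrix (Fin n) (Fin n) ℂ)) ^ k))) =
          Module.finrank ℂ
            (LinearMap.ker (Matrix.toLin' ((A ζ₂ - lam j ζ₂ • (1 : Matrix (Fin n) (Fin n) ℂ)) ^ k))))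

section

open Module Topology

theorem exists_local_section_ker {X E F : Type*} [TopologicalSpace X] [NormedAddCommGroup E]
    [NormedSpace ℂ E] [FiniteDimensional ℂ E] [NormedAddCommGroup F] [NormedSpace ℂ F]
    [FiniteDimensional ℂ F] (L : X → E →ₗ[ℂ] F) (hL : ∀ v, Continuous fun x => L x v) {x₀ : X}
    (hdim : ∀ x, finrank ℂ (LinearMap.ker (L x)) = finrank ℂ (LinearMap.ker (L x₀)))
    {v₀ : E} (hv₀ : L x₀ v₀ = 0) :
    ∃ U : Set X, IsOpen U ∧ x₀ ∈ U ∧ ∃ g : X → E, ContinuousOn g U ∧ g x₀ = v₀ ∧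
      ∀ x ∈ U, L x (g x) = 0 := by
  obtain ⟨p, hp⟩ := (LinearMap.range (L x₀)).subtype.exists_leftInverse_of_injective
    (Submodule.ker_subtype _)
  obtain ⟨s, hs⟩ := (L x₀).rangeRestrict.exists_rightInverse_of_surjective
    (L x₀).range_rangeRestrict
  let R := LinearMap.range (L x₀)
  have hp' : ∀ w : R, p w = w := fun w => LinearMap.congr_fun hp w
  have hs' : ∀ w : R, L x₀ (s w) = w := fun w => congrArg Subtype.val (LinearMap.congr_fun hs w)
  let M : X → R →L[ℂ] R := fun x => LinearMap.toContinuousLinearMap (p ∘ₗ L x ∘ₗ s)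
  have hpc : Continuous p := LinearMap.continuous_of_finiteDimensional p
  have hsc : Continuous s := LinearMap.continuous_of_finiteDimensional s
  have hM : Continuous M := continuous_clm_apply.2 fun w => hpc.comp (hL (s w))
  have hM₀ : M x₀ = 1 := by
    ext w
    simp [M, hs', hp']
  have : CompleteSpace R := FiniteDimensional.complete ℂ R
  refine ⟨M ⁻¹' {T | IsUnit T}, (Units.isOpen (R := R →L[ℂ] R)).preimage hM, by simp [hM₀],
    fun x => v₀ - s (Ring.inverse (M x) (p (L x v₀))), ?_, by simp [hv₀], ?_⟩
  · have hinv : ContinuousOn (fun x => Ring.inverse (M x)) (M ⁻¹' {T | IsUnit T}) := by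
      rintro x ⟨u, hu⟩
      exact (ContinuousAt.comp (f := M) (by
          rw [← hu]
          exact NormedRing.inverse_continuousAt (R := R →L[ℂ] R) u) hM.continuousAt).continuousWithinAt
    exact continuousOn_const.sub
      (hsc.comp_continuousOn (hinv.clm_apply (hpc.comp (hL v₀)).continuousOn))
  · intro x hx
    have hMi : ∀ w, p (L x (s (Ring.inverse (M x) w))) = w := fun w =>
      congrArg (fun T : R →L[ℂ] R => T w) (Ring.mul_inverse_cancel (M x) hx)
    have hker : LinearMap.ker (L x) = LinearMap.ker (p ∘ₗ L x) := by
      refine Submodule.eq_of_le_of_finrank_eq (LinearMap.ker_le_ker_comp _ _) ?_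
      have h1 := LinearMap.finrank_range_add_finrank_ker (p ∘ₗ L x)
      have h2 := LinearMap.finrank_range_add_finrank_ker (L x₀)
      have h3 : LinearMap.range (p ∘ₗ L x) = ⊤ :=
        LinearMap.range_eq_top.2 fun w => ⟨_, hMi w⟩
      rw [h3, finrank_top] at h1
      rw [hdim x]
      omega
    change _ ∈ LinearMap.ker (L x)
    rw [hker, LinearMap.mem_ker, LinearMap.comp_apply, map_sub, map_sub, hMi, sub_self]

section

variable {X κ : Type*} {n : ℕ}

section Local

attribute [local instance] Matrix.linftyOpNormedAddCommGroup Matrix.linftyOpNormedSpace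

theorem exists_local_intertwiner [TopologicalSpace X] [Fintype κ]
    {Y : κ → X → Matrix (Fin n) (Fin n) ℂ} (hY : ∀ o, Continuous (Y o))
    (hsim : ∀ x y, ∃ G : Matrix (Fin n) (Fin n) ℂ, IsUnit G ∧ ∀ o, Y o x * G = G * Y o y)
    (x₀ : X) :
    ∃ U : Set X, IsOpen U ∧ x₀ ∈ U ∧ ∃ g : X → Matrix (Fin n) (Fin n) ℂ, ContinuousOn g U ∧
      ∀ x ∈ U, IsUnit (g x) ∧ ∀ o, Y o x * g x = g x * Y o x₀ := by
  let L : X → Matrix (Fin n) (Fin n) ℂ →ₗ[ℂ] (κ → Matrix (Fin n) (Fin n) ℂ) := fun x =>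
    LinearMap.pi fun o => LinearMap.mulLeft ℂ (Y o x) - LinearMap.mulRight ℂ (Y o x₀)
  have hLmem : ∀ x v, L x v = 0 ↔ ∀ o, Y o x * v = v * Y o x₀ := by
    intro x v
    simp [L, funext_iff, sub_eq_zero]
  have hle : ∀ x y, finrank ℂ (LinearMap.ker (L x)) ≤ finrank ℂ (LinearMap.ker (L y)) := by
    intro x y
    obtain ⟨G, hG, hGY⟩ := hsim y x
    have hmem : ∀ v ∈ LinearMap.ker (L x), LinearMap.mulLeft ℂ G v ∈ LinearMap.ker (L y) := by
      intro v hv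
      rw [LinearMap.mem_ker, hLmem] at *
      intro o
      rw [LinearMap.mulLeft_apply, ← mul_assoc, hGY, mul_assoc, hv o, mul_assoc]
    refine LinearMap.finrank_le_finrank_of_injective
      (f := (LinearMap.mulLeft ℂ G).restrict hmem) fun v w h => ?_
    exact Subtype.ext (hG.mul_left_cancel (congrArg Subtype.val h))
  obtain ⟨U, hU, hxU, g, hg, hg₀, hgL⟩ := exists_local_section_ker L
    (fun v => continuous_pi fun o =>
      (((hY o).matrix_mul continuous_const).sub continuous_const))
    (fun x => le_antisymm (hle _ _) (hle _ _)) (x₀ := x₀) (v₀ := 1) ((hLmem _ _).2 fun o => by simp)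
  have hdet : ContinuousOn (fun x => (g x).det) U :=
    continuous_id.matrix_det.comp_continuousOn hg
  refine ⟨U ∩ (fun x => (g x).det) ⁻¹' {0}ᶜ, hdet.isOpen_inter_preimage hU isOpen_compl_singleton,
    ⟨hxU, by simp [hg₀]⟩, g, hg.mono Set.inter_subset_left, fun x hx => ⟨?_, ?_⟩⟩
  · rw [Matrix.isUnit_iff_isUnit_det, isUnit_iff_ne_zero]
    exact hx.2
  · exact (hLmem _ _).1 (hgL x hx.1)

end Local

theorem inv_mul_eq_mul_inv {R : Type*} [CommRing R] {A B G : Matrix (Fin n) (Fin n) R}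
    (hG : IsUnit G) (h : A * G = G * B) : G⁻¹ * A = B * G⁻¹ := by
  have hd := (Matrix.isUnit_iff_isUnit_det G).1 hG
  calc G⁻¹ * A = G⁻¹ * (A * G) * G⁻¹ := by
        rw [mul_assoc, mul_assoc, Matrix.mul_nonsing_inv _ hd, mul_one]
    _ = B * G⁻¹ := by rw [h, ← mul_assoc, Matrix.nonsing_inv_mul _ hd, one_mul]

theorem exists_continuous_intertwiner [MetricSpace X] [Fintype κ]
    {Y : κ → X → Matrix (Fin n) (Fin n) ℂ} (hY : ∀ o, Continuous (Y o))
    (hsim : ∀ x y, ∃ G : Matrix (Fin n) (Fin n) ℂ, IsUnit G ∧ ∀ o, Y o x * G = G * Y o y) :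
    ∃ S : C(X × X, Matrix (Fin n) (Fin n) ℂ),
      (∀ p o, Y o p.1 * S p = S p * Y o p.2) ∧ ∀ x, S (x, x) = 1 := by
  let t : X × X → Set (Matrix (Fin n) (Fin n) ℂ) := fun p => {S |
    (∀ o, Y o p.1 * S = S * Y o p.2) ∧ (p.1 = p.2 → S = 1)}
  have hconv : ∀ p, Convex ℝ (t p) := by
    intro p S hS T hT a b _ _ hab
    refine ⟨fun o => ?_, fun h => ?_⟩
    · simp only [mul_add, add_mul, Matrix.mul_smul, Matrix.smul_mul, hS.1 o, hT.1 o]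
    · rw [hS.2 h, hT.2 h, ← add_smul, hab, one_smul]
  have hloc : ∀ p, ∃ U ∈ 𝓝 p, ∃ g : X × X → Matrix (Fin n) (Fin n) ℂ, ContinuousOn g U ∧
      ∀ q ∈ U, g q ∈ t q := by
    rintro ⟨x₀, y₀⟩
    by_cases h : x₀ = y₀
    · subst h
      obtain ⟨U, hU, hxU, g, hg, hgU⟩ := exists_local_intertwiner hY hsim x₀
      refine ⟨U ×ˢ U, prod_mem_nhds (hU.mem_nhds hxU) (hU.mem_nhds hxU),
        fun p => g p.1 * (g p.2)⁻¹, ?_, ?_⟩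
      · refine ContinuousOn.mul (hg.comp continuousOn_fst fun p hp => hp.1) ?_
        have h2 := hg.comp continuousOn_snd (fun p (hp : p ∈ U ×ˢ U) => hp.2)
        intro p hp
        refine ContinuousAt.comp_continuousWithinAt (f := fun p : X × X => g p.2)
          (continuousAt_matrix_inv _ ?_) (h2 p hp)
        have hu := ((Matrix.isUnit_iff_isUnit_det _).1 (hgU p.2 hp.2).1)
        exact hu.unit_spec ▸ NormedRing.inverse_continuousAt hu.unit
      · rintro ⟨x, y⟩ ⟨hx, hy⟩
        refine ⟨fun o => ?_, ?_⟩
        · simp only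
          rw [← mul_assoc, (hgU x hx).2, mul_assoc, mul_assoc,
            inv_mul_eq_mul_inv (hgU y hy).1 ((hgU y hy).2 o)]
        · intro h
          obtain rfl : x = y := h
          exact Matrix.mul_nonsing_inv _ ((Matrix.isUnit_iff_isUnit_det _).1 (hgU x hx).1)
    · exact ⟨{p | p.1 ≠ p.2}, (isOpen_ne_fun continuous_fst continuous_snd).mem_nhds h,
        fun _ => 0, continuousOn_const, fun p hp => ⟨fun o => by simp, fun h => absurd h hp⟩⟩
  obtain ⟨S, hS⟩ := exists_continuous_forall_mem_convex_of_local hconv hloc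
  exact ⟨S, fun p => (hS p).1, fun x => (hS (x, x)).2 rfl⟩

open unitInterval in
theorem exists_continuous_trivialization [MetricSpace X] [ContractibleSpace X] [Fintype κ]
    {Y : κ → X → Matrix (Fin n) (Fin n) ℂ} (hY : ∀ o, Continuous (Y o))
    (hsim : ∀ x y, ∃ G : Matrix (Fin n) (Fin n) ℂ, IsUnit G ∧ ∀ o, Y o x * G = G * Y o y)
    (x₀ : X) :
    ∃ T : X → Matrix (Fin n) (Fin n) ℂ, Continuous T ∧ (∀ x, IsUnit (T x)) ∧
      ∀ x o, Y o x * T x = T x * Y o x₀ := by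
  obtain ⟨S, hS, hS1⟩ := exists_continuous_intertwiner hY hsim
  obtain ⟨p, ⟨H⟩⟩ := id_nullhomotopic X
  have hopen : IsOpen {q : X × (I × I) | IsUnit (S (H (q.2.1, q.1), H (q.2.2, q.1)))} := by
    simp only [Matrix.isUnit_iff_isUnit_det, isUnit_iff_ne_zero]
    refine isOpen_ne_fun (Continuous.matrix_det ?_) continuous_const
    fun_prop
  let t : X → Set ℝ := fun x => {c | 0 < c ∧ ∀ s s' : I, dist s s' < c →
    IsUnit (S (H (s, x), H (s', x)))}
  have hconv : ∀ x, Convex ℝ (t x) := by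
    intro x
    refine Set.OrdConnected.convex ⟨fun a ha b hb c hc => ?_⟩
    exact ⟨ha.1.trans_le hc.1, fun s s' h => hb.2 s s' (h.trans_le hc.2)⟩
  have hloc : ∀ x, ∃ c : ℝ, ∀ᶠ y in 𝓝 x, c ∈ t y := by
    intro x
    obtain ⟨u, v, hu, hv, hxu, hdv, huv⟩ := generalized_tube_lemma (isCompact_singleton (x := x))
      (isCompact_diagonal (X := I)) hopen (by
        rintro ⟨y, s, s'⟩ ⟨_, h⟩
        obtain rfl : s = s' := h
        simp [hS1])
    have hvU : v ∈ uniformity I := by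
      rw [← nhdsSet_diagonal_eq_uniformity]
      exact hv.mem_nhdsSet.2 hdv
    obtain ⟨c, hc, hcv⟩ := Metric.mem_uniformity_dist.1 hvU
    refine ⟨c, ?_⟩
    filter_upwards [hu.mem_nhds (hxu rfl)] with y hy
    exact ⟨hc, fun s s' h => huv (Set.mk_mem_prod hy (hcv h))⟩
  obtain ⟨δ, hδ⟩ := exists_continuous_forall_mem_convex_of_local_const hconv hloc
  let c : ℕ → X → I := fun k x => Set.projIcc 0 1 zero_le_one (k * (δ x / 2))
  have hc : ∀ k, Continuous (c k) := fun k =>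
    continuous_projIcc.comp (continuous_const.mul (δ.continuous.div_const 2))
  have hc0 : ∀ x, c 0 x = 0 := by
    intro x
    simp only [c, Nat.cast_zero, zero_mul]
    exact Set.projIcc_left _
  have hc1 : ∀ (k : ℕ) x, 1 ≤ k * (δ x / 2) → c k x = 1 := fun k x h => Set.projIcc_of_right_le _ h
  have hcd : ∀ (k : ℕ) x, dist (c k x) (c (k + 1) x) < δ x := by
    intro k x
    have h1 := Set.abs_projIcc_sub_projIcc (zero_le_one (α := ℝ))
      (c := k * (δ x / 2)) (d := (k + 1 : ℕ) * (δ x / 2))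
    have h2 : ((k : ℝ) * (δ x / 2) - (k + 1 : ℕ) * (δ x / 2)) = - (δ x / 2) := by push_cast; ring
    have h3 := (hδ x).1
    rw [h2, abs_neg, abs_of_pos (half_pos h3)] at h1
    exact h1.trans_lt (half_lt_self h3)
  let T : ℕ → X → Matrix (Fin n) (Fin n) ℂ := fun k =>
    Nat.rec (fun _ => 1) (fun k T x => T x * S (H (c k x, x), H (c (k + 1) x, x))) k
  have hTs : ∀ k x, T (k + 1) x = T k x * S (H (c k x, x), H (c (k + 1) x, x)) := fun _ _ => rfl
  have hTc : ∀ k, Continuous (T k) := by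
    intro k
    induction k with
    | zero => exact continuous_const
    | succ k ih =>
      refine ih.mul (S.continuous.comp ?_)
      have h1 := hc k
      have h2 := hc (k + 1)
      fun_prop
  have hTu : ∀ k x, IsUnit (T k x) := by
    intro k x
    induction k with
    | zero => exact isUnit_one
    | succ k ih => exact ih.mul ((hδ x).2 _ _ (hcd k x))
  have hTY : ∀ k x o, Y o x * T k x = T k x * Y o (H (c k x, x)) := by
    intro k x o
    induction k with
    | zero =>
      have h : H (0, x) = x := H.apply_zero x
      rw [hc0, h]
      exact (mul_one _).trans (one_mul _).symm
    | succ k ih =>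
      rw [hTs, ← mul_assoc, ih, mul_assoc, mul_assoc]
      congr 1
      exact hS (H (c k x, x), H (c (k + 1) x, x)) o
  have hstab : ∀ (k l : ℕ) x, 1 ≤ k * (δ x / 2) → k ≤ l → T l x = T k x := by
    intro k l x hk hkl
    induction l, hkl using Nat.le_induction with
    | base => rfl
    | succ l hl ih =>
      have h3 := (hδ x).1
      have h1 : 1 ≤ l * (δ x / 2) := hk.trans (by gcongr)
      have h2 : 1 ≤ (l + 1 : ℕ) * (δ x / 2) := h1.trans (by gcongr; omega)
      rw [hTs, hc1 l x h1, hc1 _ x h2, hS1, mul_one, ih]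
  have hlarge : ∀ x, ∃ k : ℕ, 1 < k * (δ x / 2) := by
    intro x
    obtain ⟨k, hk⟩ := exists_nat_gt (1 / (δ x / 2))
    exact ⟨k, (div_lt_iff₀ (half_pos (hδ x).1)).1 hk⟩
  choose N hN using hlarge
  have hcont : Continuous fun x => T (N x) x := by
    refine continuous_iff_continuousAt.2 fun x => ?_
    refine (hTc (N x)).continuousAt.congr ?_
    have hnear : ∀ᶠ y in 𝓝 x, 1 < N x * (δ y / 2) :=
      (continuous_const.mul (δ.continuous.div_const 2)).continuousAt.eventually_const_lt (hN x)
    filter_upwards [hnear] with y hy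
    rcases le_total (N x) (N y) with h | h
    · exact (hstab _ _ y hy.le h).symm
    · exact hstab _ _ y (hN y).le h
  have hp : ∀ x o, Y o x * T (N x) x = T (N x) x * Y o p := by
    intro x o
    have h : H (1, x) = p := H.apply_one x
    rw [hTY, hc1 _ _ (hN x).le, h]
  have hu0 := hTu (N x₀) x₀
  refine ⟨fun x => T (N x) x * (T (N x₀) x₀)⁻¹, hcont.mul continuous_const,
    fun x => (hTu _ x).mul (Matrix.isUnit_nonsing_inv_iff.2 hu0), fun x o => ?_⟩
  simp only
  rw [← mul_assoc, hp, mul_assoc, mul_assoc, inv_mul_eq_mul_inv hu0 (hp x₀ o)]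

end

theorem isCoveringMap_of_locally_eq_range {X : Type*} [TopologicalSpace X] {σ : X → Set ℂ}
    (hσ : ∀ x, ∃ U : Set X, IsOpen U ∧ x ∈ U ∧ ∃ m : ℕ, ∃ lam : Fin m → X → ℂ,
      (∀ j, ContinuousOn (lam j) U) ∧ (∀ y ∈ U, Function.Injective fun j => lam j y) ∧
      ∀ y ∈ U, (Set.range fun j => lam j y) = σ y) :
    IsCoveringMap fun q : {q : X × ℂ // q.2 ∈ σ q.1} => q.1.1 := by
  set f := fun q : {q : X × ℂ // q.2 ∈ σ q.1} => q.1.1 with hf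
  have hfc : Continuous f := continuous_fst.comp continuous_subtype_val
  intro x
  obtain ⟨U, hU, hxU, m, lam, hc, hinj, hrange⟩ := hσ x
  have hmem : ∀ u ∈ U, ∀ i, lam i u ∈ σ u := fun u hu i => by
    rw [← hrange u hu]
    exact ⟨i, rfl⟩
  have hex : ∀ q : f ⁻¹' U, ∃ i, lam i (f q) = q.1.1.2 := by
    rintro ⟨⟨q, hq⟩, hqU⟩
    rwa [← hrange q.1 hqU] at hq
  choose idx hidx using hex
  have hidx_iff : ∀ q i, idx q = i ↔ lam i (f q) = q.1.1.2 := fun q i =>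
    ⟨fun h => h ▸ hidx q, fun h => hinj _ q.2 ((hidx q).trans h.symm)⟩
  have hlam : ∀ i, Continuous fun q : f ⁻¹' U => lam i (f q) := fun i =>
    (hc i).comp_continuous (hfc.comp continuous_subtype_val) fun q => q.2
  have hidxc : Continuous idx := by
    refine continuous_iff_isClosed.2 fun s _ => ?_
    rw [show idx ⁻¹' s = ⋃ i ∈ s, {q : f ⁻¹' U | lam i (f q) = q.1.1.2} by
      ext q
      simp only [← hidx_iff, Set.mem_iUnion, Set.mem_preimage, Set.mem_ofPred_eq, exists_prop,
        exists_eq_right']]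
    exact s.toFinite.isClosed_biUnion fun i _ => isClosed_eq (hlam i) (by fun_prop)
  have hev : IsEvenlyCovered f x (Fin m) := by
    refine ⟨inferInstance, U, hxU, hU, hU.preimage hfc,
      { toFun := fun q => (⟨f q, q.2⟩, idx q)
        invFun := fun p => ⟨⟨(p.1, lam p.2 p.1), hmem _ p.1.2 _⟩, p.1.2⟩
        left_inv := fun q => Subtype.ext (Subtype.ext (Prod.ext rfl (hidx q)))
        right_inv := fun p => Prod.ext rfl ((hidx_iff _ _).2 rfl)
        continuous_toFun := by fun_prop
        continuous_invFun := ?_ }, fun _ => rfl⟩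
    have h : Continuous fun p : U × Fin m => lam p.2 p.1 :=
      continuous_prod_of_discrete_right.2 fun i => (hc i).comp_continuous
        continuous_subtype_val Subtype.property
    exact (((continuous_subtype_val.comp continuous_fst).prodMk h).subtype_mk _).subtype_mk _
  exact hev.to_isEvenlyCovered_preimage

theorem exists_continuous_sections_of_locally_eq_range {X : Type*} [TopologicalSpace X]
    [SimplyConnectedSpace X] [LocallyPathConnectedSpace X] {σ : X → Set ℂ}
    (hσ : ∀ x, ∃ U : Set X, IsOpen U ∧ x ∈ U ∧ ∃ m : ℕ, ∃ lam : Fin m → X → ℂ,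
      (∀ j, ContinuousOn (lam j) U) ∧ (∀ y ∈ U, Function.Injective fun j => lam j y) ∧
      ∀ y ∈ U, (Set.range fun j => lam j y) = σ y) (x₀ : X) :
    ∃ g : σ x₀ → X → ℂ, (∀ j, Continuous (g j)) ∧ (∀ x, Function.Injective fun j => g j x) ∧
      ∀ x, (Set.range fun j => g j x) = σ x := by
  have cov := isCoveringMap_of_locally_eq_range hσ
  have hlift : ∀ (x : X) (c : σ x), ∃ F : C(X, {q : X × ℂ // q.2 ∈ σ q.1}),
      F x = ⟨(x, c), c.2⟩ ∧ ∀ y, (F y).1.1 = y := by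
    intro x c
    obtain ⟨F, ⟨h1, h2⟩, -⟩ := cov.existsUnique_continuousMap_lifts (ContinuousMap.id X) x
      ⟨(x, c), c.2⟩ rfl
    exact ⟨F, h1, congrFun h2⟩
  have huniq : ∀ F G : C(X, {q : X × ℂ // q.2 ∈ σ q.1}), (∀ y, (F y).1.1 = y) →
      (∀ y, (G y).1.1 = y) → ∀ x, (F x).1.2 = (G x).1.2 → ∀ y, (F y).1.2 = (G y).1.2 := by
    intro F G hF hG x hx y
    rw [cov.eq_of_comp_eq F.continuous G.continuous (funext fun y => (hF y).trans (hG y).symm) x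
      (Subtype.ext (Prod.ext ((hF x).trans (hG x).symm) hx))]
  choose F hF₀ hF using fun c : σ x₀ => hlift x₀ c
  have hFc : ∀ c, (F c x₀).1.2 = c := fun c => by rw [hF₀]
  refine ⟨fun c x => (F c x).1.2, fun c => by fun_prop, fun x c c' h => ?_, fun x => ?_⟩
  · have h := huniq _ _ (hF c) (hF c') x h x₀
    rw [hFc, hFc] at h
    exact Subtype.ext h
  · refine Set.Subset.antisymm ?_ fun z hz => ?_
    · rintro _ ⟨c, rfl⟩
      have h := (F c x).2
      rwa [hF] at h
    · obtain ⟨G, hG₀, hG⟩ := hlift x ⟨z, hz⟩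
      have hmem : (G x₀).1.2 ∈ σ x₀ := by
        have h := (G x₀).2
        rwa [hG] at h
      refine ⟨⟨_, hmem⟩, ?_⟩
      have h := huniq _ G (hF ⟨_, hmem⟩) hG x₀ (hFc _) x
      rw [hG₀] at h
      exact h

end

section

open Module Topology

theorem exists_linearEquiv_extending {K V V' : Type*} [Field K] [AddCommGroup V] [Module K V]
    [FiniteDimensional K V] [AddCommGroup V'] [Module K V'] [FiniteDimensional K V']
    (f : V →ₗ[K] V) (g : V' →ₗ[K] V') (hV : finrank K V = finrank K V')
    (hker : finrank K (LinearMap.ker f) = finrank K (LinearMap.ker g))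
    (φ : LinearMap.range f ≃ₗ[K] LinearMap.range g)
    (hφ : ∀ v : LinearMap.range f, ∀ w : LinearMap.range f, (w : V) = f v →
      (φ w : V') = g (φ v)) :
    ∃ e : V ≃ₗ[K] V', ∀ v, e (f v) = g (e v) := by
  obtain ⟨L, hLd, hLs⟩ := IsModularLattice.exists_disjoint_and_sup_eq
    (inf_le_left : LinearMap.ker f ⊓ LinearMap.range f ≤ LinearMap.ker f)
  obtain ⟨L', hLd', hLs'⟩ := IsModularLattice.exists_disjoint_and_sup_eq
    (inf_le_left : LinearMap.ker g ⊓ LinearMap.range g ≤ LinearMap.ker g)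
  have hLf : L ≤ LinearMap.ker f := hLs ▸ le_sup_right
  have hLg : L' ≤ LinearMap.ker g := hLs' ▸ le_sup_right
  have hD : Disjoint L (LinearMap.range f) := by
    rw [disjoint_iff, ← inf_eq_left.2 hLf, inf_assoc]
    exact hLd.symm.eq_bot
  have hD' : Disjoint L' (LinearMap.range g) := by
    rw [disjoint_iff, ← inf_eq_left.2 hLg, inf_assoc]
    exact hLd'.symm.eq_bot
  have hφker : ∀ w : LinearMap.range f, f w = 0 ↔ g (φ w) = 0 := by
    intro w
    have := hφ w ⟨f w, w, rfl⟩ rfl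
    rw [← this]
    simp [Subtype.ext_iff]
  have hint : finrank K ↥(LinearMap.ker f ⊓ LinearMap.range f) =
      finrank K ↥(LinearMap.ker g ⊓ LinearMap.range g) := by
    have key : (LinearMap.ker g ⊓ LinearMap.range g) =
      (((LinearMap.ker f ⊓ LinearMap.range f).comap (LinearMap.range f).subtype).map
        ((LinearMap.range g).subtype ∘ₗ φ.toLinearMap)) := by
      ext v
      simp only [Submodule.mem_inf, LinearMap.mem_ker, Submodule.mem_map, Submodule.mem_comap]
      constructor
      · rintro ⟨h1, h2⟩
        refine ⟨φ.symm ⟨v, h2⟩, ⟨?_, Subtype.coe_prop _⟩, by simp⟩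
        exact (hφker _).2 (by simpa using h1)
      · rintro ⟨w, ⟨h1, h2⟩, rfl⟩
        exact ⟨(hφker w).1 h1, Subtype.coe_prop _⟩
    rw [key, ← (Submodule.equivMapOfInjective _
      ((Subtype.val_injective).comp φ.injective) _).finrank_eq,
      (Submodule.comapSubtypeEquivOfLe inf_le_right).finrank_eq]
  have hLL : finrank K L = finrank K L' := by
    have h1 := Submodule.finrank_sup_add_finrank_inf_eq (LinearMap.ker f ⊓ LinearMap.range f) L
    have h2 := Submodule.finrank_sup_add_finrank_inf_eq (LinearMap.ker g ⊓ LinearMap.range g) L'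
    rw [hLs, hLd.eq_bot, finrank_bot] at h1
    rw [hLs', hLd'.eq_bot, finrank_bot] at h2
    omega
  let κ : L ≃ₗ[K] L' := LinearEquiv.ofFinrankEq _ _ hLL
  obtain ⟨R, hR, hRc⟩ := hD.symm.exists_isCompl
  let r : V →ₗ[K] L := Submodule.projectionOnto L R hRc.symm
  have hrL : ∀ v : L, r v = v := fun v => Submodule.projectionOnto_apply_left hRc.symm v
  have hrR : ∀ v, r (f v) = 0 := fun v =>
    (Submodule.projectionOnto_apply_eq_zero_iff hRc.symm).2 (hR ⟨v, rfl⟩)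
  obtain ⟨Φ₀, hΦ₀⟩ := LinearMap.exists_extend ((LinearMap.range g).subtype ∘ₗ φ.toLinearMap)
  have hΦ₀' : ∀ w : LinearMap.range f, Φ₀ w = φ w := fun w => LinearMap.congr_fun hΦ₀ w
  obtain ⟨s, hs⟩ := g.rangeRestrict.exists_rightInverse_of_surjective g.range_rangeRestrict
  have hs' : ∀ w : LinearMap.range g, g (s w) = w := fun w =>
    congrArg Subtype.val (LinearMap.congr_fun hs w)
  let Φ₁ : V →ₗ[K] V' := Φ₀ ∘ₗ (LinearMap.id - L.subtype ∘ₗ r) + L'.subtype ∘ₗ κ.toLinearMap ∘ₗ r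
  let E : V →ₗ[K] LinearMap.range g := g.rangeRestrict ∘ₗ Φ₁ - φ.toLinearMap ∘ₗ f.rangeRestrict
  let Φ : V →ₗ[K] V' := Φ₁ - s ∘ₗ E
  have hgΦ : ∀ v, g (Φ v) = φ (f.rangeRestrict v) := by
    intro v
    simp [Φ, E, hs']
  have h1R : ∀ w : LinearMap.range f, Φ₁ w = φ w := by
    rintro ⟨_, v, rfl⟩
    simp [Φ₁, hrR, hΦ₀' ⟨f v, v, rfl⟩]
  have h1L : ∀ w : L, Φ₁ w = κ w := by
    intro w
    simp [Φ₁, hrL]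
  have hΦR : ∀ w : LinearMap.range f, Φ w = φ w := by
    intro w
    have : E w = 0 := by
      ext
      simp [E, h1R]
      rw [sub_eq_zero]
      exact (hφ w _ rfl).symm
    simp [Φ, this, h1R]
  have hΦL : ∀ w : L, Φ w = κ w := by
    intro w
    have : E w = 0 := by
      ext
      have h2 : f.rangeRestrict (w : V) = 0 := Subtype.ext (hLf w.2)
      have h3 : g (κ w) = 0 := hLg (κ w).2
      simp [E, h1L, h2, h3]
    simp [Φ, this, h1L]
  have hinj : Function.Injective Φ := by
    rw [← LinearMap.ker_eq_bot, LinearMap.ker_eq_bot']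
    intro v hv
    have h1 : f v = 0 := by
      have := hgΦ v
      rw [hv, map_zero] at this
      have h2 : f.rangeRestrict v = 0 := by
        rw [← map_eq_zero_iff φ φ.injective]; exact Subtype.ext this.symm
      exact congrArg Subtype.val h2
    have h2 : v ∈ (LinearMap.ker f ⊓ LinearMap.range f) ⊔ L := by rw [hLs]; exact h1
    obtain ⟨u, hu, l, hl, rfl⟩ := Submodule.mem_sup.1 h2
    rw [map_add, hΦR ⟨u, hu.2⟩, hΦL ⟨l, hl⟩] at hv
    have h3 := Submodule.disjoint_def.1 hD' (κ ⟨l, hl⟩) (κ ⟨l, hl⟩).2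
      (by rw [eq_neg_of_add_eq_zero_right hv]; exact neg_mem (Subtype.coe_prop _))
    rw [h3, add_zero] at hv
    have h4 : (⟨u, hu.2⟩ : LinearMap.range f) = 0 := by
      rw [← map_eq_zero_iff φ φ.injective]; exact Subtype.ext hv
    have h5 : (⟨l, hl⟩ : L) = 0 := by
      rw [← map_eq_zero_iff κ κ.injective]; exact Subtype.ext h3
    have h4' : u = 0 := congrArg Subtype.val h4
    have h5' : l = 0 := congrArg Subtype.val h5
    rw [h4', h5', add_zero]
  refine ⟨LinearEquiv.ofInjectiveOfFinrankEq Φ hinj hV, fun v => ?_⟩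
  change Φ (f v) = g (Φ v)
  rw [hgΦ]
  exact hΦR (f.rangeRestrict v)

theorem pow_restrict_coe {K V : Type*} [Field K] [AddCommGroup V] [Module K V]
    (f : V →ₗ[K] V) {p : Submodule K V} (h : ∀ x ∈ p, f x ∈ p) (k : ℕ) (v : p) :
    (((f.restrict h) ^ k) v : V) = (f ^ k) v := by
  induction k generalizing v with
  | zero => rfl
  | succ k ih => rw [pow_succ, Module.End.mul_apply, ih, pow_succ]; rfl

theorem finrank_ker_pow_succ {K V : Type*} [Field K] [AddCommGroup V] [Module K V]
    [FiniteDimensional K V]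
    (f : V →ₗ[K] V) (h : ∀ x ∈ LinearMap.range f, f x ∈ LinearMap.range f) (k : ℕ) :
    finrank K (LinearMap.ker (f ^ (k + 1))) =
      finrank K (LinearMap.ker ((f.restrict h) ^ k)) + finrank K (LinearMap.ker f) := by
  have hmem : ∀ v ∈ LinearMap.ker (f ^ (k + 1)), f.rangeRestrict v ∈
      LinearMap.ker ((f.restrict h) ^ k) := by
    intro v hv
    apply Subtype.ext
    rw [pow_restrict_coe]
    rwa [LinearMap.mem_ker, pow_succ] at hv
  let q := f.rangeRestrict.restrict hmem
  have hq : LinearMap.range q = ⊤ := by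
    rw [LinearMap.range_eq_top]
    rintro ⟨⟨_, v, rfl⟩, hv⟩
    refine ⟨⟨v, ?_⟩, rfl⟩
    have := congrArg Subtype.val hv
    rw [pow_restrict_coe] at this
    rw [LinearMap.mem_ker, pow_succ]
    exact this
  have hk : finrank K (LinearMap.ker q) = finrank K (LinearMap.ker f) := by
    have hle : LinearMap.ker f ≤ LinearMap.ker (f ^ (k + 1)) := by
      intro v hv
      rw [LinearMap.mem_ker, pow_succ, Module.End.mul_apply, hv, map_zero]
    rw [LinearMap.ker_restrict, LinearMap.ker_rangeRestrict,
      (Submodule.comapSubtypeEquivOfLe hle).finrank_eq]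
  rw [← LinearMap.finrank_range_add_finrank_ker q, hq, hk, finrank_top]

theorem exists_linearEquiv_of_nilpotent {K : Type*} [Field K] (N : ℕ) :
    ∀ {V V' : Type _} [AddCommGroup V] [Module K V]
    [FiniteDimensional K V] [AddCommGroup V'] [Module K V'] [FiniteDimensional K V']
    (f : V →ₗ[K] V) (g : V' →ₗ[K] V'), f ^ N = 0 → g ^ N = 0 →
    (∀ k, finrank K (LinearMap.ker (f ^ k)) = finrank K (LinearMap.ker (g ^ k))) →
    ∃ e : V ≃ₗ[K] V', ∀ v, e (f v) = g (e v) := by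
  induction N with
  | zero =>
    intro V V' _ _ _ _ _ _ f g hf hg _
    have hV : Subsingleton V := ⟨fun a b => by
      have h := fun v => LinearMap.congr_fun hf v
      simp at h
      rw [h a, h b]⟩
    have hV' : Subsingleton V' := ⟨fun a b => by
      have h := fun v => LinearMap.congr_fun hg v
      simp at h
      rw [h a, h b]⟩
    exact ⟨LinearEquiv.ofSubsingleton V V', fun v => Subsingleton.elim _ _⟩
  | succ N ih =>
    intro V V' _ _ _ _ _ _ f g hf hg hk
    have hfr : ∀ x ∈ LinearMap.range f, f x ∈ LinearMap.range f := fun x _ => ⟨x, rfl⟩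
    have hgr : ∀ x ∈ LinearMap.range g, g x ∈ LinearMap.range g := fun x _ => ⟨x, rfl⟩
    have h1 := hk 1
    rw [pow_one, pow_one] at h1
    obtain ⟨φ, hφ⟩ := ih (f.restrict hfr) (g.restrict hgr)
      (by
        ext ⟨_, v, rfl⟩
        rw [pow_restrict_coe]
        simpa [pow_succ] using LinearMap.congr_fun hf v)
      (by
        ext ⟨_, v, rfl⟩
        rw [pow_restrict_coe]
        simpa [pow_succ] using LinearMap.congr_fun hg v)
      (fun k => by
        have h2 := hk (k + 1)
        rw [finrank_ker_pow_succ f hfr, finrank_ker_pow_succ g hgr] at h2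
        omega)
    refine exists_linearEquiv_extending f g ?_ h1 φ ?_
    · have h2 := hk (N + 1)
      rwa [hf, hg, LinearMap.ker_zero, LinearMap.ker_zero, finrank_top, finrank_top] at h2
    · intro v w hw
      have := congrArg Subtype.val (hφ v)
      rw [← show w = f.restrict hfr v from Subtype.ext hw] at this
      exact this

theorem exists_partial_intertwiner {K V : Type*} [Field K] [AddCommGroup V] [Module K V]
    [FiniteDimensional K V] (n : ℕ) (F H P Q : Module.End K V)
    (hFP : F ^ n * P = 0) (hP : ∀ v, (F ^ n) v = 0 → P v = v)
    (hHQ : H ^ n * Q = 0) (hQ : ∀ v, (H ^ n) v = 0 → Q v = v)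
    (hHQc : Commute H Q)
    (hdim : ∀ k ≤ n, finrank K (LinearMap.ker (F ^ k)) = finrank K (LinearMap.ker (H ^ k))) :
    ∃ G G' : Module.End K V, P * G = G ∧ G * Q = G ∧ Q * G' = G' ∧ G' * P = G' ∧
      G * G' = P ∧ G' * G = Q ∧ F * G = G * H := by
  have hst : ∀ (T : Module.End K V), ∀ v ∈ LinearMap.ker (T ^ n), T v ∈ LinearMap.ker (T ^ n) := by
    intro T v hv
    rw [LinearMap.mem_ker] at *
    rw [← Module.End.mul_apply, ← pow_succ, pow_succ', Module.End.mul_apply, hv, map_zero]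
  have hnil : ∀ (T : Module.End K V), (T.restrict (hst T)) ^ n = 0 := by
    intro T
    ext v
    rw [pow_restrict_coe]
    exact v.2
  have hfin : ∀ (T : Module.End K V) (k : ℕ), finrank K (LinearMap.ker ((T.restrict (hst T)) ^ k))
      = finrank K (LinearMap.ker (T ^ min k n)) := by
    intro T k
    have hle : LinearMap.ker (T ^ min k n) ≤ LinearMap.ker (T ^ n) := by
      intro v hv
      rw [LinearMap.mem_ker] at *
      rw [← Nat.sub_add_cancel (min_le_right k n), pow_add, Module.End.mul_apply, hv, map_zero]
    rw [← (Submodule.comapSubtypeEquivOfLe hle).finrank_eq]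
    suffices LinearMap.ker ((T.restrict (hst T)) ^ k) =
        (LinearMap.ker (T ^ min k n)).comap (LinearMap.ker (T ^ n)).subtype by rw [this]
    ext v
    simp only [LinearMap.mem_ker, Submodule.mem_comap, Submodule.subtype_apply]
    rw [Subtype.ext_iff, pow_restrict_coe, ZeroMemClass.coe_zero]
    rcases le_total k n with h | h
    · rw [min_eq_left h]
    · rw [min_eq_right h]
      refine iff_of_true ?_ v.2
      rw [← Nat.sub_add_cancel h, pow_add, Module.End.mul_apply, show (T ^ n) v = 0 from v.2, map_zero]
  obtain ⟨e, he⟩ := exists_linearEquiv_of_nilpotent n (H.restrict (hst H)) (F.restrict (hst F))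
    (hnil H) (hnil F) (fun k => by rw [hfin, hfin, hdim _ (min_le_right _ _)])
  let p : V →ₗ[K] LinearMap.ker (F ^ n) := P.codRestrict _ fun v => LinearMap.congr_fun hFP v
  let q : V →ₗ[K] LinearMap.ker (H ^ n) := Q.codRestrict _ fun v => LinearMap.congr_fun hHQ v
  have hpv : ∀ v : LinearMap.ker (F ^ n), p v = v := fun v => Subtype.ext (hP _ v.2)
  have hqv : ∀ v : LinearMap.ker (H ^ n), q v = v := fun v => Subtype.ext (hQ _ v.2)
  have hpP : ∀ v, p (P v) = p v := fun v => hpv (p v)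
  have hqQ : ∀ v, q (Q v) = q v := fun v => hqv (q v)
  refine ⟨(LinearMap.ker (F ^ n)).subtype ∘ₗ e.toLinearMap ∘ₗ q,
    (LinearMap.ker (H ^ n)).subtype ∘ₗ e.symm.toLinearMap ∘ₗ p, ?_, ?_, ?_, ?_, ?_, ?_, ?_⟩
  · ext v; exact hP _ (Subtype.coe_prop (e (q v)))
  · ext v; simp [hqQ]
  · ext v; exact hQ _ (Subtype.coe_prop (e.symm (p v)))
  · ext v; simp [hpP]
  · ext v; simp [hqv]; rfl
  · ext v; simp [hpv]; rfl
  · ext v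
    have h1 : q (H v) = H.restrict (hst H) (q v) :=
      Subtype.ext (LinearMap.congr_fun hHQc.eq v).symm
    simp [h1, he]

open Polynomial

/-- The polynomial congruent to `1` modulo `(X - s j) ^ n` and to `0` modulo `(X - s k) ^ n` for
`k ≠ j`. -/
noncomputable def idempotentPoly {ι : Type*} [Fintype ι] [DecidableEq ι] (n : ℕ) (s : ι → ℂ)
    (j : ι) : ℂ[X] :=
  1 - (1 - (∏ k ∈ Finset.univ.erase j, (C (s j - s k)⁻¹ * (X - C (s k)))) ^ n) ^ n

section

variable {ι : Type*} [Fintype ι] [DecidableEq ι] (n : ℕ) {s : ι → ℂ}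

theorem pow_dvd_one_sub_idempotentPoly (hs : Function.Injective s) (j : ι) :
    (X - C (s j)) ^ n ∣ 1 - idempotentPoly n s j := by
  rw [idempotentPoly, sub_sub_cancel]
  refine pow_dvd_pow_of_dvd ?_ n
  rw [dvd_iff_isRoot, IsRoot.def]
  have : eval (s j) (∏ k ∈ Finset.univ.erase j, (C (s j - s k)⁻¹ * (X - C (s k)))) = 1 := by
    rw [eval_prod]
    refine Finset.prod_eq_one fun k hk => ?_
    have : s j - s k ≠ 0 := sub_ne_zero.2 (hs.ne (Finset.ne_of_mem_erase hk).symm)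
    simp [this]
  simp only [eval_sub, eval_one, eval_pow, this, one_pow, sub_self]

theorem pow_dvd_idempotentPoly {j k : ι} (h : k ≠ j) :
    (X - C (s k)) ^ n ∣ idempotentPoly n s j := by
  have h1 := sub_dvd_pow_sub_pow (1 : ℂ[X])
    (1 - (∏ k ∈ Finset.univ.erase j, (C (s j - s k)⁻¹ * (X - C (s k)))) ^ n) n
  rw [one_pow, sub_sub_cancel] at h1
  refine (pow_dvd_pow_of_dvd ?_ n).trans h1
  exact (dvd_mul_left _ _).trans
    (Finset.dvd_prod_of_mem _ (Finset.mem_erase.2 ⟨h, Finset.mem_univ k⟩))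

variable {R : Type*} [Ring R] [Algebra ℂ R] {a : R}

omit [DecidableEq ι] in
theorem aeval_eq_zero_of_forall_pow_dvd (hs : Function.Injective s)
    (ha : aeval a (∏ k, (X - C (s k)) ^ n) = 0) {p : ℂ[X]} (hp : ∀ k, (X - C (s k)) ^ n ∣ p) :
    aeval a p = 0 := by
  have : (∏ k, (X - C (s k)) ^ n) ∣ p := by
    refine Finset.prod_dvd_of_coprime (fun i _ j _ hij => ?_) fun k _ => hp k
    exact (isCoprime_X_sub_C_of_isUnit_sub (sub_ne_zero.2 (hs.ne hij)).isUnit).pow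
  obtain ⟨q, rfl⟩ := this
  rw [map_mul, ha, zero_mul]

theorem aeval_idempotentPoly_mul_of_ne (hs : Function.Injective s)
    (ha : aeval a (∏ k, (X - C (s k)) ^ n) = 0) {i j : ι} (hij : i ≠ j) :
    aeval a (idempotentPoly n s i) * aeval a (idempotentPoly n s j) = 0 := by
  rw [← map_mul]
  refine aeval_eq_zero_of_forall_pow_dvd n hs ha fun k => ?_
  by_cases h : k = i
  · exact (pow_dvd_idempotentPoly n (h ▸ hij)).mul_left _
  · exact (pow_dvd_idempotentPoly n h).mul_right _

theorem sum_aeval_idempotentPoly (hs : Function.Injective s)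
    (ha : aeval a (∏ k, (X - C (s k)) ^ n) = 0) :
    ∑ j, aeval a (idempotentPoly n s j) = 1 := by
  rw [← map_sum, ← sub_eq_zero, ← map_one (aeval (R := ℂ) a), ← map_sub]
  refine aeval_eq_zero_of_forall_pow_dvd n hs ha fun k => ?_
  rw [← Finset.add_sum_erase _ _ (Finset.mem_univ k), add_sub_right_comm]
  refine dvd_add ?_ (Finset.dvd_sum fun j hj =>
    pow_dvd_idempotentPoly n (Finset.ne_of_mem_erase hj).symm)
  rw [← neg_sub (1 : ℂ[X])]
  exact (pow_dvd_one_sub_idempotentPoly n hs k).neg_right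

theorem aeval_idempotentPoly_mul_self (hs : Function.Injective s)
    (ha : aeval a (∏ k, (X - C (s k)) ^ n) = 0) (i : ι) :
    aeval a (idempotentPoly n s i) * aeval a (idempotentPoly n s i) =
      aeval a (idempotentPoly n s i) := by
  conv_rhs => rw [← mul_one (aeval a (idempotentPoly n s i)), ← sum_aeval_idempotentPoly n hs ha,
    Finset.mul_sum, Finset.sum_eq_single i
      (fun j _ hj => aeval_idempotentPoly_mul_of_ne n hs ha hj.symm) (by simp)]

theorem pow_mul_aeval_idempotentPoly (hs : Function.Injective s)
    (ha : aeval a (∏ k, (X - C (s k)) ^ n) = 0) (j : ι) :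
    (a - algebraMap ℂ R (s j)) ^ n * aeval a (idempotentPoly n s j) = 0 := by
  have : a - algebraMap ℂ R (s j) = aeval a (X - C (s j)) := by simp
  rw [this, ← map_pow, ← map_mul]
  refine aeval_eq_zero_of_forall_pow_dvd n hs ha fun k => ?_
  by_cases h : k = j
  · rw [h]; exact dvd_mul_right _ _
  · exact (pow_dvd_idempotentPoly n h).mul_left _

/-- The nilpotent part of `a` with respect to the candidate eigenvalues `s`. -/
noncomputable def nilpotentPart (n : ℕ) (s : ι → ℂ) (a : R) : R :=
  a - ∑ j, s j • aeval a (idempotentPoly n s j)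

theorem nilpotentPart_mul_aeval_idempotentPoly (hs : Function.Injective s)
    (ha : aeval a (∏ k, (X - C (s k)) ^ n) = 0) (j : ι) :
    nilpotentPart n s a * aeval a (idempotentPoly n s j) =
      (a - algebraMap ℂ R (s j)) * aeval a (idempotentPoly n s j) := by
  rw [nilpotentPart, sub_mul, sub_mul, Finset.sum_mul, Finset.sum_eq_single j, smul_mul_assoc,
    aeval_idempotentPoly_mul_self n hs ha, Algebra.smul_def]
  · intro i _ hi
    rw [smul_mul_assoc, aeval_idempotentPoly_mul_of_ne n hs ha hi, smul_zero]
  · simp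

omit [Fintype ι] [DecidableEq ι] in
theorem commute_aeval_right {b : R} (h : Commute b a) (p : ℂ[X]) : Commute b (aeval a p) := by
  induction p using Polynomial.induction_on' with
  | add p q hp hq => rw [map_add]; exact hp.add_right hq
  | monomial k c =>
    rw [aeval_monomial]
    exact (Algebra.commute_algebraMap_right c b).mul_right (h.pow_right k)

theorem commute_nilpotentPart_right {b : R} (h : Commute b a) :
    Commute b (nilpotentPart n s a) :=
  h.sub_right (Commute.sum_right _ _ _ fun _ _ => (commute_aeval_right h _).smul_right _)

end

theorem exists_isUnit_intertwiner {V : Type*} [AddCommGroup V] [Module ℂ V]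
    [FiniteDimensional ℂ V] {ι : Type*} [Fintype ι] [DecidableEq ι] (n : ℕ) {s t : ι → ℂ}
    (hs : Function.Injective s) (ht : Function.Injective t) (f g : Module.End ℂ V)
    (hf : aeval f (∏ k, (X - C (s k)) ^ n) = 0) (hg : aeval g (∏ k, (X - C (t k)) ^ n) = 0)
    (hdim : ∀ j, ∀ k ≤ n, finrank ℂ (LinearMap.ker ((f - algebraMap ℂ _ (s j)) ^ k)) =
      finrank ℂ (LinearMap.ker ((g - algebraMap ℂ _ (t j)) ^ k))) :
    ∃ G : Module.End ℂ V, IsUnit G ∧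
      (∀ j, aeval f (idempotentPoly n s j) * G = G * aeval g (idempotentPoly n t j)) ∧
      nilpotentPart n s f * G = G * nilpotentPart n t g := by
  have hfix : ∀ {s : ι → ℂ} (hs : Function.Injective s) (f : Module.End ℂ V) (j : ι) (v : V),
      ((f - algebraMap ℂ _ (s j)) ^ n) v = 0 → aeval f (idempotentPoly n s j) v = v := by
    intro s hs f j v hv
    obtain ⟨q, hq⟩ := pow_dvd_one_sub_idempotentPoly n hs j
    have h1 := congrArg (aeval f) hq
    rw [mul_comm] at h1
    simp only [map_sub, map_one, map_mul, map_pow, aeval_X, aeval_C] at h1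
    have h2 := LinearMap.congr_fun h1 v
    rw [Module.End.mul_apply, hv, map_zero] at h2
    exact (sub_eq_zero.1 h2).symm
  have hc : ∀ (g : Module.End ℂ V) (z : ℂ) (j : ι),
      Commute (g - algebraMap ℂ _ z) (aeval g (idempotentPoly n t j)) := fun g z j =>
    (commute_aeval_right (Commute.refl g) _).sub_left (Algebra.commutes _ _)
  choose G G' h1 h2 h3 h4 h5 h6 h7 using fun j => exists_partial_intertwiner n
    (f - algebraMap ℂ _ (s j)) (g - algebraMap ℂ _ (t j)) (aeval f (idempotentPoly n s j))
    (aeval g (idempotentPoly n t j)) (pow_mul_aeval_idempotentPoly n hs hf j) (hfix hs f j)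
    (pow_mul_aeval_idempotentPoly n ht hg j) (hfix ht g j)
    (hc g (t j) j) (hdim j)
  have hPG : ∀ i j, i ≠ j → aeval f (idempotentPoly n s i) * G j = 0 := fun i j h => by
    rw [← h1 j, ← mul_assoc, aeval_idempotentPoly_mul_of_ne n hs hf h, zero_mul]
  have hGQ : ∀ i j, i ≠ j → G i * aeval g (idempotentPoly n t j) = 0 := fun i j h => by
    rw [← h2 i, mul_assoc, aeval_idempotentPoly_mul_of_ne n ht hg h, mul_zero]
  have hQG : ∀ i j, i ≠ j → aeval g (idempotentPoly n t i) * G' j = 0 := fun i j h => by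
    rw [← h3 j, ← mul_assoc, aeval_idempotentPoly_mul_of_ne n ht hg h, zero_mul]
  have hunit : (∑ j, G j) * (∑ j, G' j) = 1 := by
    rw [Finset.sum_mul, ← sum_aeval_idempotentPoly n hs hf]
    refine Finset.sum_congr rfl fun j _ => ?_
    rw [Finset.mul_sum, Finset.sum_eq_single j, h5]
    · intro i _ hi
      rw [← h2 j, mul_assoc, hQG _ _ hi.symm, mul_zero]
    · simp
  refine ⟨∑ j, G j, IsUnit.of_mul_eq_one _ hunit, fun j => ?_, ?_⟩
  · rw [Finset.mul_sum, Finset.sum_mul, Finset.sum_eq_single j, Finset.sum_eq_single j, h1, h2]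
    · exact fun i _ hi => hGQ i j hi
    · simp
    · exact fun i _ hi => hPG j i hi.symm
    · simp
  · rw [Finset.mul_sum, Finset.sum_mul]
    refine Finset.sum_congr rfl fun j _ => ?_
    have hN : Commute (nilpotentPart n t g) (aeval g (idempotentPoly n t j)) :=
      (commute_nilpotentPart_right n (commute_aeval_right (Commute.refl g) _).symm).symm
    rw [← h1 j, ← mul_assoc, nilpotentPart_mul_aeval_idempotentPoly n hs hf, mul_assoc, h1, h7,
      ← h2 j, mul_assoc, mul_assoc, ← hN.eq, nilpotentPart_mul_aeval_idempotentPoly n ht hg, (hc g (t j) j).eq]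

theorem aeval_prod_X_sub_C_pow_eq_zero {n : ℕ} {ι : Type*} [Fintype ι] {s : ι → ℂ}
    (hs : Function.Injective s) {M : Matrix (Fin n) (Fin n) ℂ}
    (hM : Set.range s = spectrum ℂ M) : aeval M (∏ k, (X - C (s k)) ^ n) = 0 := by
  classical
  have hdvd : M.charpoly ∣ ∏ k, (X - C (s k)) ^ n := by
    have hsplit := (IsAlgClosed.splits M.charpoly).eq_prod_roots_of_monic M.charpoly_monic
    rw [hsplit, Finset.prod_multiset_map_count,
      ← Finset.prod_image (s := Finset.univ) (g := s) (f := fun z => (X - C z) ^ n) hs.injOn]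
    refine (Finset.prod_dvd_prod_of_dvd _ (fun z => (X - C z) ^ n) fun z _ => ?_).trans
      (Finset.prod_dvd_prod_of_subset _ _ _ fun z hz => ?_)
    · refine pow_dvd_pow _ ((Multiset.count_le_card _ _).trans ((card_roots' _).trans ?_))
      rw [Matrix.charpoly_natDegree_eq_dim, Fintype.card_fin]
    · have h : z ∈ Set.range s := by
        rw [hM, Matrix.mem_spectrum_iff_isRoot_charpoly]
        exact isRoot_of_mem_roots (Multiset.mem_toFinset.1 hz)
      simpa using h
  obtain ⟨q, hq⟩ := hdvd
  rw [hq, map_mul, Matrix.aeval_self_charpoly, zero_mul]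

theorem exists_isUnit_matrix_intertwiner {n : ℕ} {ι : Type*} [Fintype ι] [DecidableEq ι]
    {s t : ι → ℂ} (hs : Function.Injective s) (ht : Function.Injective t)
    {M N : Matrix (Fin n) (Fin n) ℂ} (hM : Set.range s = spectrum ℂ M)
    (hN : Set.range t = spectrum ℂ N)
    (hdim : ∀ j, ∀ k ≤ n, finrank ℂ (LinearMap.ker (Matrix.toLin' ((M - s j • 1) ^ k))) =
      finrank ℂ (LinearMap.ker (Matrix.toLin' ((N - t j • 1) ^ k)))) :
    ∃ G : Matrix (Fin n) (Fin n) ℂ, IsUnit G ∧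
      (∀ j, aeval M (idempotentPoly n s j) * G = G * aeval N (idempotentPoly n t j)) ∧
      nilpotentPart n s M * G = G * nilpotentPart n t N := by
  let e : Matrix (Fin n) (Fin n) ℂ ≃ₐ[ℂ] Module.End ℂ (Fin n → ℂ) := Matrix.toLinAlgEquiv'
  have hker : ∀ (K : Matrix (Fin n) (Fin n) ℂ) (c : ℂ) (k : ℕ),
      (e K - algebraMap ℂ _ c) ^ k = Matrix.toLin' ((K - c • 1) ^ k) := by
    intro K c k
    have h : Matrix.toLin' ((K - c • 1) ^ k) = e ((K - c • 1) ^ k) := rfl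
    rw [h, map_pow, map_sub, map_smul, map_one, Algebra.algebraMap_eq_smul_one]
  have hnil : ∀ (u : ι → ℂ) (K : Matrix (Fin n) (Fin n) ℂ),
      nilpotentPart n u (e K) = e (nilpotentPart n u K) := by
    intro u K
    simp only [nilpotentPart, map_sub, map_sum, map_smul, aeval_algHom_apply]
  obtain ⟨G, hG, hGP, hGN⟩ := exists_isUnit_intertwiner n hs ht (e M) (e N)
    (by rw [aeval_algHom_apply, aeval_prod_X_sub_C_pow_eq_zero hs hM, map_zero])
    (by rw [aeval_algHom_apply, aeval_prod_X_sub_C_pow_eq_zero ht hN, map_zero])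
    (fun j k hk => by rw [hker, hker]; exact hdim j k hk)
  obtain ⟨G, rfl⟩ := e.surjective G
  refine ⟨G, (MulEquiv.isUnit_map e).1 hG, fun j => e.injective ?_, e.injective ?_⟩
  · rw [map_mul, map_mul, ← aeval_algHom_apply, ← aeval_algHom_apply, hGP]
  · rw [map_mul, map_mul, ← hnil, ← hnil, hGN]

section

variable {Z ι : Type*} [TopologicalSpace Z] [Fintype ι] [DecidableEq ι] {n : ℕ}
  {A : Z → Matrix (Fin n) (Fin n) ℂ} {s : ι → Z → ℂ}

theorem continuous_aeval_idempotentPoly (hA : Continuous A) (hs : ∀ j, Continuous (s j))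
    (hinj : ∀ z, Function.Injective fun i => s i z) (j : ι) :
    Continuous fun z => aeval (A z) (idempotentPoly n (fun i => s i z) j) := by
  simp only [idempotentPoly, map_sub, map_one, map_pow]
  refine continuous_const.sub ((continuous_const.sub (Continuous.pow ?_ n)).pow n)
  suffices h : Continuous fun z => aeval (A z)
      ((∏ k ∈ Finset.univ.erase j, fun z => C (s j z - s k z)⁻¹ * (X - C (s k z))) z) by
    simpa only [Finset.prod_apply] using h
  refine Finset.prod_induction (fun k z => C (s j z - s k z)⁻¹ * (X - C (s k z)))
    (fun p : Z → ℂ[X] => Continuous fun z => aeval (A z) (p z)) (fun p q hp hq => ?_) ?_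
    fun k hk => ?_
  · simp only [Pi.mul_apply, map_mul]
    exact hp.mul hq
  · simpa only [Pi.one_apply, map_one] using continuous_const
  · simp only [map_mul, map_sub, aeval_X, aeval_C]
    have hinv : Continuous fun z => (s j z - s k z)⁻¹ := ((hs j).sub (hs k)).inv₀ fun z =>
      sub_ne_zero.2 fun h => Finset.ne_of_mem_erase hk (hinj z h.symm)
    simp only [Algebra.algebraMap_eq_smul_one]
    fun_prop

theorem continuous_nilpotentPart (hA : Continuous A) (hs : ∀ j, Continuous (s j))
    (hinj : ∀ z, Function.Injective fun i => s i z) :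
    Continuous fun z => nilpotentPart n (fun i => s i z) (A z) :=
  hA.sub (continuous_finsetSum _ fun j _ =>
    (hs j).smul (continuous_aeval_idempotentPoly hA hs hinj j))

end

theorem commute_iff_commute_nilpotentPart {n : ℕ} {ι : Type*} [Fintype ι] [DecidableEq ι]
    (s : ι → ℂ) {R : Type*} [Ring R] [Algebra ℂ R] {a b : R} :
    Commute b a ↔ Commute b (nilpotentPart n s a) ∧
      ∀ j, Commute b (aeval a (idempotentPoly n s j)) := by
  refine ⟨fun h => ⟨commute_nilpotentPart_right n h, fun j => commute_aeval_right h _⟩, fun h => ?_⟩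
  have ha : a = nilpotentPart n s a + ∑ j, s j • aeval a (idempotentPoly n s j) :=
    (sub_add_cancel _ _).symm
  rw [ha]
  exact h.1.add_right (Commute.sum_right _ _ _ fun j _ => (h.2 j).smul_right _)

theorem isLocallyConstant_finrank_ker {Z ι : Type*} [TopologicalSpace Z] {n : ℕ}
    {A : Z → Matrix (Fin n) (Fin n) ℂ} {s : ι → Z → ℂ} (hs : ∀ j, Continuous (s j))
    (hsσ : ∀ z j, s j z ∈ spectrum ℂ (A z))
    (hJ : ∀ z, ∃ U : Set Z, IsOpen U ∧ z ∈ U ∧ ∃ m : ℕ, ∃ lam : Fin m → Z → ℂ,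
      (∀ j, ContinuousOn (lam j) U) ∧ (∀ y ∈ U, Function.Injective fun j => lam j y) ∧
      (∀ y ∈ U, (Set.range fun j => lam j y) = spectrum ℂ (A y)) ∧
      ∀ j, ∀ k, 1 ≤ k → k ≤ n → ∀ y₁ ∈ U, ∀ y₂ ∈ U,
        finrank ℂ (LinearMap.ker (Matrix.toLin' ((A y₁ - lam j y₁ • 1) ^ k))) =
          finrank ℂ (LinearMap.ker (Matrix.toLin' ((A y₂ - lam j y₂ • 1) ^ k))))
    (j : ι) {k : ℕ} (hk : k ≤ n) :
    IsLocallyConstant fun z =>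
      finrank ℂ (LinearMap.ker (Matrix.toLin' ((A z - s j z • 1) ^ k))) := by
  refine (IsLocallyConstant.iff_eventually_eq _).2 fun z => ?_
  obtain ⟨U, hU, hzU, m, lam, hc, hinj, hrange, hdim⟩ := hJ z
  have hmem : ∀ y ∈ U, ∃ i, lam i y = s j y := fun y hy => by
    have h := hsσ y j
    rwa [← hrange y hy] at h
  obtain ⟨i, hi⟩ := hmem z hzU
  have hne : ∀ᶠ y in 𝓝 z, ∀ i', i' ≠ i → lam i' y ≠ s j y := by
    refine Filter.eventually_all.2 fun i' => ?_
    by_cases hii : i' = i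
    · simp [hii]
    · have h : lam i' z ≠ s j z := fun h => hii (hinj z hzU (h.trans hi.symm))
      have hev := (((hc i').continuousAt (hU.mem_nhds hzU)).sub
        (hs j).continuousAt).eventually_ne (sub_ne_zero.2 h)
      filter_upwards [hev] with y hy _ using sub_ne_zero.1 hy
  filter_upwards [hne, hU.mem_nhds hzU] with y hy hyU
  obtain ⟨i', hi'⟩ := hmem y hyU
  obtain rfl : i' = i := by_contra fun h => hy i' h hi'
  rcases Nat.eq_zero_or_pos k with rfl | hk0
  · rw [pow_zero, pow_zero]
  · rw [← hi', ← hi]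
    exact hdim i' k hk0 hk y hyU z hzU

theorem exists_continuous_commutant_trivialization {Z : Type*} [MetricSpace Z]
    [ContractibleSpace Z] [LocallyPathConnectedSpace Z] {n : ℕ}
    {A : Z → Matrix (Fin n) (Fin n) ℂ} (hA : Continuous A)
    (hJ : ∀ z, ∃ U : Set Z, IsOpen U ∧ z ∈ U ∧ ∃ m : ℕ, ∃ lam : Fin m → Z → ℂ,
      (∀ j, ContinuousOn (lam j) U) ∧ (∀ y ∈ U, Function.Injective fun j => lam j y) ∧
      (∀ y ∈ U, (Set.range fun j => lam j y) = spectrum ℂ (A y)) ∧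
      ∀ j, ∀ k, 1 ≤ k → k ≤ n → ∀ y₁ ∈ U, ∀ y₂ ∈ U,
        finrank ℂ (LinearMap.ker (Matrix.toLin' ((A y₁ - lam j y₁ • 1) ^ k))) =
          finrank ℂ (LinearMap.ker (Matrix.toLin' ((A y₂ - lam j y₂ • 1) ^ k)))) (z₀ : Z) :
    ∃ T : Z → Matrix (Fin n) (Fin n) ℂ, Continuous T ∧ (∀ z, IsUnit (T z)) ∧
      ∀ z Θ, Commute Θ (A z) ↔ Commute ((T z)⁻¹ * Θ * T z) (A z₀) := by
  classical
  obtain ⟨s, hs, hinj, hrange⟩ := exists_continuous_sections_of_locally_eq_range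
    (σ := fun z => spectrum ℂ (A z)) (fun z => by
      obtain ⟨U, hU, hzU, m, lam, hc, hi, hr, -⟩ := hJ z
      exact ⟨U, hU, hzU, m, lam, hc, hi, hr⟩) z₀
  have : Fintype (spectrum ℂ (A z₀)) := (Matrix.finite_spectrum (A z₀)).fintype
  let Y : Option (spectrum ℂ (A z₀)) → Z → Matrix (Fin n) (Fin n) ℂ := fun o z =>
    o.elim (nilpotentPart n (fun i => s i z) (A z))
      fun j => aeval (A z) (idempotentPoly n (fun i => s i z) j)
  have hY : ∀ o, Continuous (Y o) := by
    rintro (_ | j)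
    · exact continuous_nilpotentPart hA hs hinj
    · exact continuous_aeval_idempotentPoly hA hs hinj j
  have hsim : ∀ x y, ∃ G : Matrix (Fin n) (Fin n) ℂ, IsUnit G ∧ ∀ o, Y o x * G = G * Y o y := by
    intro x y
    obtain ⟨G, hG, hGP, hGN⟩ := exists_isUnit_matrix_intertwiner (hinj x) (hinj y) (hrange x)
      (hrange y) fun j k hk => (isLocallyConstant_finrank_ker hs (fun z j => by
        rw [← hrange z]
        exact ⟨j, rfl⟩) hJ j hk).apply_eq_of_preconnectedSpace x y
    exact ⟨G, hG, fun o => o.rec hGN hGP⟩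
  obtain ⟨T, hT, hTu, hTY⟩ := exists_continuous_trivialization hY hsim z₀
  refine ⟨T, hT, hTu, fun z Θ => ?_⟩
  have hcomm : ∀ z (Θ : Matrix (Fin n) (Fin n) ℂ), Commute Θ (A z) ↔ ∀ o, Commute Θ (Y o z) :=
    fun z Θ => by
      rw [commute_iff_commute_nilpotentPart (n := n) fun i => s i z, Option.forall]
      rfl
  rw [hcomm, hcomm]
  refine forall_congr' fun o => ?_
  have hd := (Matrix.isUnit_iff_isUnit_det _).1 (hTu z)
  have hYz : Y o z₀ = (T z)⁻¹ * Y o z * T z := by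
    rw [mul_assoc, hTY, ← mul_assoc, Matrix.nonsing_inv_mul _ hd, one_mul]
  obtain ⟨u, hu⟩ := hTu z
  rw [hYz, ← hu, ← Matrix.coe_units_inv]
  simp only [Commute, SemiconjBy, mul_assoc, Units.mul_inv_cancel_left, Units.mul_right_inj]
  rw [← mul_assoc, ← mul_assoc (Y o z), Units.mul_left_inj]

end

/-- On a contractible open set `W ⊆ ℂᵈ` all of whose points are Jordan stable for a holomorphic
`A : W → Mat(n×n,ℂ)`, there is a continuous invertible-valued `T : W → Mat(n×n,ℂ)` with
`T(ζ)⁻¹·(Com A(ζ))·T(ζ) = Com A(ξ)` for all `ζ ∈ W`. -/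
theorem com_global_conjugation_on_contractible (d n : ℕ)
    (W : Set (Fin d → ℂ)) (hW : IsOpen W) (hWc : ContractibleSpace W)
    (A : (Fin d → ℂ) → Matrix (Fin n) (Fin n) ℂ)
    (hA : ∀ i j, DifferentiableOn ℂ (fun ζ => A ζ i j) W)
    (hJ : ∀ ξ ∈ W, JordanStable W A ξ)
    (ξ : Fin d → ℂ) (hξ : ξ ∈ W) :
    ∃ T : (Fin d → ℂ) → Matrix (Fin n) (Fin n) ℂ,
      ContinuousOn T W ∧
      (∀ ζ ∈ W, IsUnit (T ζ)) ∧
      (∀ ζ ∈ W,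
        (fun Θ => (T ζ)⁻¹ * Θ * T ζ) '' {Θ | Θ * A ζ = A ζ * Θ} =
          {Θ | Θ * A ξ = A ξ * Θ}) := by
  have := hW.locallyPathConnectedSpace
  have hAc : Continuous fun z : W => A z := continuous_matrix fun i j =>
    (hA i j).continuousOn.comp_continuous continuous_subtype_val Subtype.property
  obtain ⟨T, hT, hTu, hTA⟩ := exists_continuous_commutant_trivialization hAc (fun z => by
    obtain ⟨U, hU, hzU, -, m, lam, hd, hi, hr, hk⟩ := hJ z z.2
    exact ⟨Subtype.val ⁻¹' U, hU.preimage continuous_subtype_val, hzU, m, fun j z => lam j z,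
      fun j => (hd j).continuousOn.comp continuous_subtype_val.continuousOn fun _ h => h,
      fun y hy => hi y hy, fun y hy => hr y hy,
      fun j k h1 hkn y₁ h₁ y₂ h₂ => hk j k h1 hkn y₁ h₁ y₂ h₂⟩) ⟨ξ, hξ⟩
  classical
  refine ⟨fun ζ => if h : ζ ∈ W then T ⟨ζ, h⟩ else 1, ?_, fun ζ hζ => ?_, fun ζ hζ => ?_⟩
  · rw [continuousOn_iff_continuous_domRestrict]
    exact hT.congr fun z => by simp
  · simpa [hζ] using hTu ⟨ζ, hζ⟩
  · simp only [hζ, dif_pos]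
    have hd := (Matrix.isUnit_iff_isUnit_det _).1 (hTu ⟨ζ, hζ⟩)
    refine Set.Subset.antisymm ?_ fun Θ hΘ => ?_
    · rintro _ ⟨Θ, hΘ, rfl⟩
      exact (hTA ⟨ζ, hζ⟩ Θ).1 hΘ
    · have h : (T ⟨ζ, hζ⟩)⁻¹ * (T ⟨ζ, hζ⟩ * Θ * (T ⟨ζ, hζ⟩)⁻¹) * T ⟨ζ, hζ⟩ = Θ := by
        simp only [mul_assoc, Matrix.nonsing_inv_mul _ hd, mul_one]
        rw [← mul_assoc, Matrix.nonsing_inv_mul _ hd, one_mul]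
      exact ⟨T ⟨ζ, hζ⟩ * Θ * (T ⟨ζ, hζ⟩)⁻¹, (hTA ⟨ζ, hζ⟩ _).2 (h.symm ▸ hΘ), h⟩
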